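/- arXiv:1407.5189 — 3 statements merged into one kernel-verified Lean document; each statement's English description precedes it below -/
import Mathlib

section
/- Let k ≥ 1 be an integer and κ₀ ≥ 1. Let r be a real polynomial of degree at most k with r(0) = 1 satisfying condition (i): |r(λ)| ≤ κ₀ for all λ ∈ [0,1]. Let g be the polynomial determined by r(λ) = 1 − λ·g(λ). Then sup_{λ ∈ [0,1]} |√λ · g(λ)| ≤ 2κ₀k, equivalently λ·g(λ)² ≤ 4κ₀²k² for all λ ∈ [0,1]. -/
open Polynomial Polynomial.Chebyshev in
/-- The value at `t` of a polynomial of degree at most `n`, by Lagrange interpolation at the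
Chebyshev nodes. -/
theorem sumNodes_lagrange_eq_eval {n : ℕ} {P : ℝ[X]} (hP : P.natDegree ≤ n) (t : ℝ) :
    sumNodes n (fun i => ∏ j ∈ (Finset.range (n + 1)).erase i,
      (t - node n j) / (node n i - node n j)) P = P.eval t := by
  have hdeg : P.degree < (Finset.range (n + 1)).card := by
    rw [Finset.card_range]
    exact lt_of_le_of_lt (degree_le_of_natDegree_le hP) (by norm_cast; simp)
  conv_rhs => rw [Lagrange.eq_interpolate (strictAntiOn_node n).injOn hdeg]
  rw [Lagrange.interpolate_apply, eval_finsetSum, sumNodes, ← Nat.range_succ_eq_Iic]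
  refine Finset.sum_congr rfl fun i _ => ?_
  simp only [eval_mul, eval_C, Lagrange.basis, Lagrange.basisDivisor, eval_prod, eval_sub, eval_X]
  congr 1
  refine Finset.prod_congr rfl fun j _ => ?_
  rw [div_eq_inv_mul]

open Polynomial Polynomial.Chebyshev in
/-- Among polynomials of degree at most `n` bounded by one on `[-1, 1]`, the Chebyshev polynomial
drops the most from `1` to any point right of its second extremum. -/
theorem eval_one_sub_eval_le_T {n : ℕ} {P : ℝ[X]} (hP : P.natDegree ≤ n)
    (hbnd : ∀ x ∈ Set.Icc (-1) 1, |P.eval x| ≤ 1) {t : ℝ} (ht : node n 1 ≤ t) (ht' : t ≤ 1) :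
    P.eval 1 - P.eval t ≤ 1 - (T ℝ n).eval t := by
  set ℓ : ℕ → ℝ := fun i => ∏ j ∈ (Finset.range (n + 1)).erase i,
    (t - node n j) / (node n i - node n j) with hℓ
  have key (Q : ℝ[X]) (hQ : Q.natDegree ≤ n) :
      sumNodes n (fun i => (if i = 0 then 1 else 0) - ℓ i) Q = Q.eval 1 - Q.eval t := by
    rw [← sumNodes_lagrange_eq_eval hQ t]
    simp [sumNodes, mul_sub, Finset.sum_sub_distrib, node_eq_one, hℓ]
  have node_le {j : ℕ} (hj : j ∈ Finset.range (n + 1)) (hj0 : j ≠ 0) : node n j ≤ t :=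
    ((strictAntiOn_node n).antitoneOn (by simp at hj ⊢; omega) (by simpa using hj)
      (Nat.one_le_iff_ne_zero.mpr hj0)).trans ht
  have sign (i : ℕ) (hi : i ≤ n) : 0 ≤ (-1 : ℝ) ^ i * ((if i = 0 then 1 else 0) - ℓ i) := by
    rcases eq_or_ne i 0 with rfl | hi0
    · simp only [pow_zero, one_mul, if_true, sub_nonneg, hℓ]
      have hlt {j : ℕ} (hj : j ∈ (Finset.range (n + 1)).erase 0) : 0 < node n 0 - node n j :=
        sub_pos.mpr (node_lt (by simp at hj; omega) (by simp at hj; omega))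
      refine Finset.prod_le_one (fun j hj => ?_) fun j hj => ?_
      · have := node_le (Finset.mem_of_mem_erase hj) (Finset.ne_of_mem_erase hj)
        exact div_nonneg (sub_nonneg.mpr this) (hlt hj).le
      · rw [div_le_one (hlt hj), node_eq_one]
        linarith
    · have h0 : 0 ∈ (Finset.range (n + 1)).erase i := by simp [hi0.symm]
      have hnum : 0 ≤ -∏ j ∈ (Finset.range (n + 1)).erase i, (t - node n j) := by
        rw [← Finset.mul_prod_erase _ _ h0, ← neg_mul, node_eq_one]
        refine mul_nonneg (by linarith) (Finset.prod_nonneg fun j hj => ?_)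
        rw [Finset.mem_erase, Finset.mem_erase] at hj
        exact sub_nonneg.mpr (node_le hj.2.2 hj.1)
      have hden := zero_lt_prod_node_sub_node hi
      rw [if_neg hi0, hℓ]
      simp only [Finset.prod_div_distrib]
      have hsq : ((-1 : ℝ) ^ i) * (-1) ^ i = 1 := by simp [← mul_pow]
      refine (div_nonneg hnum hden.le).trans_eq ?_
      rw [div_eq_mul_inv _ ((-1 : ℝ) ^ i * _), mul_inv, inv_eq_of_mul_eq_one_left hsq]
      ring
  rw [← key P hP]
  convert sumNodes_le_sumNodes_T sign hbnd using 1
  rw [key _ (by simp)]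
  simp

open Polynomial Polynomial.Chebyshev in
theorem one_sub_eval_T_le (n : ℕ) {t : ℝ} (ht : -1 ≤ t) (ht' : t ≤ 1) :
    1 - (T ℝ n).eval t ≤ n ^ 2 * (1 - t) := by
  have h := (convex_Icc (-1 : ℝ) 1).norm_image_sub_le_of_norm_deriv_le
    (f := fun x => (T ℝ n).eval x) (C := (n : ℝ) ^ 2) (x := t) (y := 1)
    (fun x _ => (T ℝ n).differentiableAt) (fun x hx => ?_) ⟨ht, ht'⟩ (by simp)
  · simp only [T_eval_one, Real.norm_eq_abs, abs_of_nonneg (sub_nonneg.mpr ht')] at h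
    exact (le_abs_self _).trans h
  · have := abs_iterate_derivative_T_real_le n 1 (abs_le.mpr hx)
    simpa [derivative_T_eval_one] using this

open Polynomial Polynomial.Chebyshev in
/-- A Markov-type inequality for difference quotients at the left endpoint of `[0, 1]`. -/
theorem eval_zero_sub_eval_le {k : ℕ} {M : ℝ} (hM : 0 < M) {P : ℝ[X]} (hP : P.natDegree ≤ k)
    (hbnd : ∀ x ∈ Set.Icc (0 : ℝ) 1, |P.eval x| ≤ M) {x : ℝ} (hx : 0 ≤ x)
    (hx' : x ≤ 1) (hnode : node k 1 ≤ 1 - 2 * x) :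
    P.eval 0 - P.eval x ≤ 2 * M * k ^ 2 * x := by
  set Q : ℝ[X] := C M⁻¹ * P.comp (C (1 / 2) * (1 - X)) with hQ
  have hQe (y : ℝ) : Q.eval y = M⁻¹ * P.eval ((1 - y) / 2) := by
    simp [hQ]
    left
    congr 1
    ring
  have hQd : Q.natDegree ≤ k := by
    refine (natDegree_C_mul_le _ _).trans (natDegree_comp_le.trans ?_)
    have : (C (1 / 2 : ℝ) * (1 - X)).natDegree ≤ 1 := by compute_degree
    nlinarith
  have hQb : ∀ y ∈ Set.Icc (-1 : ℝ) 1, |Q.eval y| ≤ 1 := fun y hy => by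
    rw [hQe, abs_mul, abs_of_pos (inv_pos.mpr hM), inv_mul_le_one₀ hM]
    exact hbnd _ ⟨by linarith [hy.2], by linarith [hy.1]⟩
  have h := (eval_one_sub_eval_le_T hQd hQb hnode (by linarith)).trans
    (one_sub_eval_T_le k (by linarith) (by linarith))
  rw [hQe, hQe, ← mul_sub, inv_mul_le_iff₀ hM] at h
  ring_nf at h ⊢
  exact h

open Polynomial.Chebyshev in
theorem node_one_le_one_sub {k : ℕ} (hk : 1 ≤ k) : node k 1 ≤ 1 - 2 / (k : ℝ) ^ 2 := by
  have hk0 : (1 : ℝ) ≤ k := by exact_mod_cast hk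
  have hs := Real.mul_le_sin (x := Real.pi / (2 * k)) (by positivity)
    (by gcongr; linarith)
  have heq : 2 / Real.pi * (Real.pi / (2 * k)) = 1 / (k : ℝ) := by field_simp
  rw [heq] at hs
  have hc : node k 1 = 1 - 2 * Real.sin (Real.pi / (2 * k)) ^ 2 := by
    have h2 : ((1 : ℕ) : ℝ) * Real.pi / k = 2 * (Real.pi / (2 * k)) := by
      push_cast
      field_simp
    rw [node, h2, Real.cos_two_mul, Real.cos_sq']
    ring
  have := pow_le_pow_left₀ (by positivity) hs 2
  rw [hc, show 2 / (k : ℝ) ^ 2 = 2 * (1 / k) ^ 2 by ring]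
  linarith

theorem stmt_1 (k : ℕ) (hk : 1 ≤ k) (κ₀ : ℝ) (hκ₀ : 1 ≤ κ₀)
    (r g : Polynomial ℝ) (hdeg : r.natDegree ≤ k) (hr0 : r.eval 0 = 1)
    (hrg : ∀ x : ℝ, r.eval x = 1 - x * g.eval x)
    (hi : ∀ x ∈ Set.Icc (0:ℝ) 1, |r.eval x| ≤ κ₀) :
    ∀ x ∈ Set.Icc (0:ℝ) 1,
      |Real.sqrt x * g.eval x| ≤ 2 * κ₀ * (k : ℝ) ∧
      x * (g.eval x) ^ 2 ≤ 4 * κ₀ ^ 2 * (k : ℝ) ^ 2 := by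
  have hk0 : (1 : ℝ) ≤ k := by exact_mod_cast hk
  have main : ∀ x ∈ Set.Icc (0 : ℝ) 1, |Real.sqrt x * g.eval x| ≤ 2 * κ₀ * k := by
    rintro x ⟨hx0, hx1⟩
    obtain rfl | hx := hx0.eq_or_lt
    · simp only [Real.sqrt_zero, zero_mul, abs_zero]
      positivity
    have hs := Real.sqrt_pos.mpr hx
    have hss := Real.mul_self_sqrt hx0
    have hxg : x * g.eval x = r.eval 0 - r.eval x := by rw [hrg x, hr0]; ring
    suffices h : |r.eval 0 - r.eval x| ≤ 2 * κ₀ * k * √x by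
      rw [← hxg] at h
      rw [← mul_le_mul_iff_left₀ hs]
      calc |√x * g.eval x| * √x = |√x * √x * g.eval x| := by
            rw [mul_right_comm, abs_mul _ (√x), abs_of_pos hs]
        _ ≤ _ := by rwa [hss]
    rcases le_or_gt 1 (k * √x) with h1 | h1
    · have h2 := abs_sub (r.eval 0) (r.eval x)
      have h3 := hi x ⟨hx0, hx1⟩
      have h4 := hi 0 (by simp)
      nlinarith
    · have hkx : (k : ℝ) ^ 2 * x < 1 := by
        rw [← Real.sq_sqrt hx0, ← mul_pow]
        exact pow_lt_one₀ (by positivity) h1 two_ne_zero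
      have hnode : Polynomial.Chebyshev.node k 1 ≤ 1 - 2 * x := by
        refine (node_one_le_one_sub hk).trans ?_
        have : x ≤ 1 / (k : ℝ) ^ 2 := by
          rw [le_div_iff₀ (by positivity)]
          linarith
        rw [show 2 / (k : ℝ) ^ 2 = 2 * (1 / k ^ 2) by ring]
        linarith
      have hpos := eval_zero_sub_eval_le (by linarith) hdeg hi hx0 hx1 hnode
      have hneg := eval_zero_sub_eval_le (P := -r) (M := κ₀) (by linarith) (by simpa using hdeg)
        (by simpa using hi) hx0 hx1 hnode
      simp only [Polynomial.eval_neg] at hneg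
      have hle : 2 * κ₀ * (k : ℝ) ^ 2 * x ≤ 2 * κ₀ * k * √x := by
        calc 2 * κ₀ * (k : ℝ) ^ 2 * x = 2 * κ₀ * k * √x * (k * √x) := by
              rw [← hss, Real.sqrt_mul_self hs.le]; ring
          _ ≤ 2 * κ₀ * k * √x := mul_le_of_le_one_right (by positivity) h1.le
      exact abs_le.mpr ⟨by linarith, by linarith⟩
  intro x hx
  refine ⟨main x hx, ?_⟩
  have h := pow_le_pow_left₀ (abs_nonneg _) (main x hx) 2
  rw [sq_abs, mul_pow, Real.sq_sqrt hx.1] at h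
  linarith
end

section
/- Let k ≥ 1 be an integer, κ₀ ≥ 1 and κ₂ > 0. Let r be a real polynomial of degree at most k satisfying condition (i): |r(λ)| ≤ κ₀ for all λ ∈ [0,1], and condition (ii)₂: |λ·r(λ)| ≤ κ₂/(k+1)² for all λ ∈ [0,1]. Then |λ·(r(λ) − r(τ))| ≤ (κ₀ + 2κ₂)·|λ − τ| for all λ, τ ∈ [0,1]. -/
open Polynomial

/-- The endpoint case of Markov's inequality on `[-1, 1]`. -/
lemma abs_eval_one_derivative_le {n : ℕ} {P : ℝ[X]} (hdeg : P.natDegree ≤ n)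
    (hP : ∀ x ∈ Set.Icc (-1 : ℝ) 1, |P.eval x| ≤ 1) :
    |(derivative P).eval 1| ≤ (n : ℝ) ^ 2 := by
  have key : ∀ R : ℝ[X], R.natDegree ≤ n → (∀ x ∈ Set.Icc (-1 : ℝ) 1, |R.eval x| ≤ 1) →
      (derivative R).eval 1 ≤ (n : ℝ) ^ 2 := fun R hR hb => by
    simpa [Chebyshev.derivative_T_eval_one] using
      Chebyshev.eval_iterate_derivative_le_of_forall_abs_le_one (k := 1) le_rfl
        (natDegree_le_iff_degree_le.mp hR) hb
  rw [abs_le']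
  exact ⟨key P hdeg hP, by simpa using key (-P) (by simpa using hdeg) (by simpa using hP)⟩

/-- The endpoint case of Schur's inequality. -/
lemma abs_eval_one_le_of_one_sub_sq_mul_sq_le {m : ℕ} {Q : ℝ[X]} (hdeg : Q.natDegree ≤ m)
    (hQ : ∀ x ∈ Set.Icc (-1 : ℝ) 1, (1 - x ^ 2) * Q.eval x ^ 2 ≤ 1) :
    |Q.eval 1| ≤ m + 1 := by
  have hW := abs_eval_one_derivative_le (n := 2 * (m + 1))
    (P := 1 - C 2 * ((1 - X ^ 2) * Q ^ 2)) (by compute_degree; omega) (fun x hx => by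
      have h0 : 0 ≤ (1 - x ^ 2) * Q.eval x ^ 2 :=
        mul_nonneg (by nlinarith [hx.1, hx.2]) (sq_nonneg _)
      have h1 := hQ x hx
      simp only [eval_sub, eval_one, eval_mul, eval_C, eval_pow, eval_X]
      rw [abs_le]
      constructor <;> linarith)
  have heval : (derivative (1 - C 2 * ((1 - X ^ 2) * Q ^ 2))).eval 1 = 4 * Q.eval 1 ^ 2 := by
    simp
    ring
  rw [heval] at hW
  push_cast at hW
  apply abs_le_of_sq_le_sq _ (by positivity)
  nlinarith [(abs_le.mp hW).2]

/-- **Schur's inequality**. -/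
lemma abs_eval_le_of_one_sub_sq_mul_sq_le {m : ℕ} {Q : ℝ[X]} (hdeg : Q.natDegree ≤ m)
    (hQ : ∀ x ∈ Set.Icc (-1 : ℝ) 1, (1 - x ^ 2) * Q.eval x ^ 2 ≤ 1)
    {a : ℝ} (ha : a ∈ Set.Icc (-1 : ℝ) 1) : |Q.eval a| ≤ m + 1 := by
  have ha2 : a ^ 2 ≤ 1 := by nlinarith [ha.1, ha.2]
  have h := abs_eval_one_le_of_one_sub_sq_mul_sq_le (m := m) (Q := Q.comp (C a * X)) (by
      refine natDegree_comp_le.trans ?_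
      have := (natDegree_C_mul_le a X).trans natDegree_X_le
      nlinarith) (fun x hx => by
      have hx2 : x ^ 2 ≤ 1 := by nlinarith [hx.1, hx.2]
      have hax : (a * x) ^ 2 ≤ x ^ 2 := by nlinarith [sq_nonneg x]
      have hmem : a * x ∈ Set.Icc (-1 : ℝ) 1 :=
        abs_le.mp ((sq_le_one_iff_abs_le_one _).mp (hax.trans hx2))
      have := hQ _ hmem
      simp only [eval_comp, eval_mul, eval_C, eval_X]
      nlinarith [sq_nonneg (Q.eval (a * x))])
  simpa using h

/-- Composition of a polynomial with a rotation of the unit circle, split into the parts even and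
odd in the second coordinate. -/
lemma exists_eval_rotation_eq (c s : ℝ) (n : ℕ) (p : ℝ[X]) (hp : p.natDegree ≤ n) :
    ∃ A B : ℝ[X], A.degree ≤ n ∧ B.degree < n ∧
      (∀ y t : ℝ, t ^ 2 = 1 - y ^ 2 → p.eval (c * y + s * t) = A.eval y + t * B.eval y) ∧
      A.eval 1 = p.eval c ∧ B.eval 1 = s * (derivative p).eval c := by
  induction n generalizing p with
  | zero =>
    obtain ⟨a, rfl⟩ := natDegree_eq_zero.mp (Nat.le_zero.mp hp)
    exact ⟨C a, 0, degree_C_le, by simp, by simp, by simp, by simp⟩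
  | succ n ih =>
    obtain ⟨A, B, hA, hB, hAB, hA1, hB1⟩ := ih p.divX (by
      rw [natDegree_divX_eq_natDegree_tsub_one]; omega)
    have hA' := natDegree_le_iff_degree_le.mpr hA
    have hpX := divX_mul_X_add p
    refine ⟨C c * X * A + C s * (1 - X ^ 2) * B + C (p.coeff 0), C c * X * B + C s * A,
      ?_, ?_, fun y t ht => ?_, ?_, ?_⟩
    · by_cases hB0 : B = 0
      · subst hB0
        rw [← natDegree_le_iff_degree_le]
        simp only [mul_zero, add_zero]
        compute_degree
        omega
      · have hB' := (natDegree_lt_iff_degree_lt hB0).mpr hB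
        rw [← natDegree_le_iff_degree_le]
        compute_degree
        omega
    · refine lt_of_le_of_lt (b := (n : WithBot ℕ)) ?_ (by exact_mod_cast Nat.lt_succ_self n)
      rw [← natDegree_le_iff_degree_le]
      by_cases hB0 : B = 0
      · subst hB0
        rw [mul_zero, zero_add]
        exact (natDegree_C_mul_le s A).trans hA'
      · have hB' := (natDegree_lt_iff_degree_lt hB0).mpr hB
        compute_degree
        omega
    · rw [← hpX]
      simp only [eval_add, eval_mul, eval_C, eval_X, eval_sub, eval_one, eval_pow, hAB y t ht]
      simp
      linear_combination s * B.eval y * ht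
    · conv_rhs => rw [← hpX]
      simp [hA1]
      ring
    · conv_rhs => rw [← hpX]
      simp [hA1, hB1]
      ring

/-- **Bernstein's inequality** for polynomials bounded on `[-1, 1]`. -/
lemma one_sub_sq_mul_sq_derivative_le {n : ℕ} {p : ℝ[X]} (hdeg : p.natDegree ≤ n)
    (hp : ∀ x ∈ Set.Icc (-1 : ℝ) 1, |p.eval x| ≤ 1) {c : ℝ} (hc : c ∈ Set.Icc (-1 : ℝ) 1) :
    (1 - c ^ 2) * (derivative p).eval c ^ 2 ≤ (n : ℝ) ^ 2 := by
  set s := √(1 - c ^ 2) with hs_def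
  have hs : s ^ 2 = 1 - c ^ 2 := Real.sq_sqrt (by nlinarith [hc.1, hc.2])
  obtain ⟨A, B, -, hB, hAB, -, hB1⟩ := exists_eval_rotation_eq c s n p hdeg
  rw [← hs, ← mul_pow, ← hB1]
  by_cases hB0 : B = 0
  · simp [hB0]
  have hBn := (natDegree_lt_iff_degree_lt hB0).mpr hB
  have h := abs_eval_one_le_of_one_sub_sq_mul_sq_le (m := n - 1) (Q := B) (by omega)
    (fun y hy => by
      set t := √(1 - y ^ 2) with ht_def
      have ht : t ^ 2 = 1 - y ^ 2 := Real.sq_sqrt (by nlinarith [hy.1, hy.2])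
      have hcirc : ∀ u : ℝ, u ^ 2 = 1 - y ^ 2 → c * y + s * u ∈ Set.Icc (-1 : ℝ) 1 :=
        fun u hu => abs_le.mp ((sq_le_one_iff_abs_le_one _).mp (by
          have : (c * y + s * u) ^ 2 + (s * y - c * u) ^ 2 = 1 := by
            linear_combination (y ^ 2 + u ^ 2) * hs + hu
          nlinarith [sq_nonneg (s * y - c * u)]))
      have hnt : (-t) ^ 2 = 1 - y ^ 2 := by rw [neg_sq, ht]
      have h1 := abs_le.mp (hp _ (hcirc t ht))
      have h2 := abs_le.mp (hp _ (hcirc (-t) hnt))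
      rw [hAB y t ht] at h1
      rw [hAB y (-t) hnt] at h2
      rw [← ht, ← mul_pow, sq_le_one_iff_abs_le_one, abs_le]
      constructor <;> linarith [h1.1, h1.2, h2.1, h2.2])
  rw [Nat.cast_sub (by omega), Nat.cast_one, sub_add_cancel] at h
  exact sq_le_sq' (abs_le.mp h).1 (abs_le.mp h).2

/-- **Markov brothers' inequality** for the first derivative. -/
lemma abs_eval_derivative_le {n : ℕ} {p : ℝ[X]} (hdeg : p.natDegree ≤ n)
    (hp : ∀ x ∈ Set.Icc (-1 : ℝ) 1, |p.eval x| ≤ 1) {x : ℝ} (hx : x ∈ Set.Icc (-1 : ℝ) 1) :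
    |(derivative p).eval x| ≤ (n : ℝ) ^ 2 := by
  rcases Nat.eq_zero_or_pos n with rfl | hn
  · obtain ⟨a, rfl⟩ := natDegree_eq_zero.mp (Nat.le_zero.mp hdeg)
    simp
  have hn' : (0 : ℝ) < n := by exact_mod_cast hn
  have h := abs_eval_le_of_one_sub_sq_mul_sq_le (m := n - 1) (Q := C (n : ℝ)⁻¹ * derivative p)
    ((natDegree_C_mul_le _ _).trans ((natDegree_derivative_le p).trans (by omega)))
    (fun y hy => by
      have hb := one_sub_sq_mul_sq_derivative_le hdeg hp hy
      rw [eval_mul, eval_C, mul_pow, inv_pow, mul_left_comm]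
      exact inv_mul_le_one_of_le₀ hb (by positivity)) hx
  rw [Nat.cast_sub (by omega), Nat.cast_one, sub_add_cancel, eval_mul, eval_C, abs_mul,
    abs_of_pos (inv_pos.mpr hn'), inv_mul_le_iff₀ hn'] at h
  rwa [sq]

/-- **Markov brothers' inequality** for the first derivative, on the interval `[0, 1]`. -/
lemma abs_eval_derivative_le_unitInterval {n : ℕ} {q : ℝ[X]} {M : ℝ} (hdeg : q.natDegree ≤ n)
    (hM : 0 < M) (hq : ∀ x ∈ Set.Icc (0 : ℝ) 1, |q.eval x| ≤ M) {x : ℝ}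
    (hx : x ∈ Set.Icc (0 : ℝ) 1) : |(derivative q).eval x| ≤ 2 * (n : ℝ) ^ 2 * M := by
  have h := abs_eval_derivative_le (n := n) (p := C M⁻¹ * q.comp (C (1 / 2) * X + C (1 / 2)))
    (by
      refine (natDegree_C_mul_le _ _).trans (natDegree_comp_le.trans ?_)
      have := natDegree_linear_le (a := (1 / 2 : ℝ)) (b := 1 / 2)
      nlinarith)
    (fun y hy => by
      have hb := hq (1 / 2 * y + 1 / 2) ⟨by linarith [hy.1], by linarith [hy.2]⟩
      simp only [eval_mul, eval_C, eval_comp, eval_add, eval_X]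
      rw [abs_mul, abs_of_pos (inv_pos.mpr hM)]
      exact inv_mul_le_one_of_le₀ hb hM.le)
    (x := 2 * x - 1) ⟨by linarith [hx.1], by linarith [hx.2]⟩
  have heval : (derivative (C M⁻¹ * q.comp (C (1 / 2) * X + C (1 / 2)))).eval (2 * x - 1) =
      (2 * M)⁻¹ * (derivative q).eval x := by
    rw [derivative_C_mul, derivative_comp]
    simp only [eval_mul, eval_C, eval_comp, eval_add, eval_X, derivative_add, derivative_C_mul,
      derivative_X, derivative_C, eval_one, eval_zero]
    rw [show (1 / 2 : ℝ) * (2 * x - 1) + 1 / 2 = x by ring, mul_inv]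
    ring
  rw [heval, abs_mul, abs_of_pos (by positivity), inv_mul_le_iff₀ (by positivity)] at h
  linarith

theorem stmt_4 (k : ℕ) (hk : 1 ≤ k) (κ₀ κ₂ : ℝ) (hκ₀ : 1 ≤ κ₀) (hκ₂ : 0 < κ₂)
    (r : Polynomial ℝ) (hdeg : r.natDegree ≤ k)
    (hi : ∀ x ∈ Set.Icc (0:ℝ) 1, |r.eval x| ≤ κ₀)
    (hii : ∀ x ∈ Set.Icc (0:ℝ) 1, |x * r.eval x| ≤ κ₂ / ((k : ℝ) + 1) ^ 2) :
    ∀ x ∈ Set.Icc (0:ℝ) 1, ∀ τ ∈ Set.Icc (0:ℝ) 1,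
      |x * (r.eval x - r.eval τ)| ≤ (κ₀ + 2 * κ₂) * |x - τ| := by
  intro x hx τ hτ
  have hderiv : ∀ y ∈ Set.Icc (0 : ℝ) 1, ‖deriv (fun z => (X * r).eval z) y‖ ≤ 2 * κ₂ := by
    intro y hy
    rw [Polynomial.deriv, Real.norm_eq_abs]
    refine (abs_eval_derivative_le_unitInterval (n := k + 1) (M := κ₂ / ((k : ℝ) + 1) ^ 2)
      (natDegree_mul_le.trans (by rw [natDegree_X]; omega)) (by positivity)
      (by simpa using hii) hy).trans_eq ?_
    push_cast
    field_simp
  have hlip := (convex_Icc (0 : ℝ) 1).norm_image_sub_le_of_norm_deriv_le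
    (fun y _ => (X * r).differentiable.differentiableAt) hderiv hτ hx
  simp only [eval_mul, eval_X, Real.norm_eq_abs] at hlip
  calc |x * (r.eval x - r.eval τ)|
      = |(x * r.eval x - τ * r.eval τ) - r.eval τ * (x - τ)| := by ring_nf
    _ ≤ |x * r.eval x - τ * r.eval τ| + |r.eval τ| * |x - τ| := by
        rw [← abs_mul]; exact abs_sub _ _
    _ ≤ 2 * κ₂ * |x - τ| + κ₀ * |x - τ| := by
        gcongr
        exact hi τ hτ
    _ = (κ₀ + 2 * κ₂) * |x - τ| := by ring
end

section
/- Let X be a complex Hilbert space, A and A_Ω bounded linear operators on X with ‖A‖ ≤ 1 and ‖A_Ω‖ ≤ 1. Let μ, ρ, δ > 0, let v ∈ X with ‖v‖ ≤ ρ, let x† = (A*A)^{μ/2} v, f = A x†, and f_δ ∈ X with ‖f − f_δ‖ ≤ δ. Let k ≥ 1 be an integer, κ₀ ≥ 1, κ_μ > 0, and let r be a real polynomial of degree at most k with r(0) = 1 satisfying |r(λ)| ≤ κ₀ and λ^{μ/2}·|r(λ)| ≤ κ_μ/(k+1)^μ for all λ ∈ [0,1]; let g be the polynomial with r(λ) =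 1 − λ·g(λ). Then ‖x† − g(A_Ω*A_Ω)A_Ω* f_δ‖ ≤ κ_μ·ρ·k^{−μ} + 2κ₀·k·δ + 2κ₀·k²·‖x†‖·(‖A*A − A_Ω*A_Ω‖ + ‖A_Ω*(A_Ω − A)‖). -/
/-- Zeros of the Chebyshev polynomial `T (m + 1)`. -/
noncomputable def chebyshevZero (m j : ℕ) : ℝ :=
  Real.cos ((2 * j + 1) * Real.pi / (2 * (m + 1)))

lemma chebyshevZero_angle_mem {m j : ℕ} (hj : j ≤ m) :
    ((2 * j + 1) * Real.pi / (2 * (m + 1)) : ℝ) ∈ Set.Ioo 0 Real.pi := by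
  have hj' : (j : ℝ) ≤ m := by exact_mod_cast hj
  refine ⟨by positivity, ?_⟩
  rw [div_lt_iff₀ (by positivity)]
  nlinarith [Real.pi_pos]

lemma chebyshevZero_lt {m i j : ℕ} (hj : j ≤ m) (hij : i < j) :
    chebyshevZero m j < chebyshevZero m i := by
  have hi := chebyshevZero_angle_mem (hij.le.trans hj)
  have hj := chebyshevZero_angle_mem hj
  have hij' : (i : ℝ) < j := by exact_mod_cast hij
  refine Real.cos_lt_cos_of_nonneg_of_le_pi hi.1.le hj.2.le ?_
  gcongr

lemma prod_inv_chebyshevZero_sub_pos {m j : ℕ} (hj : j ≤ m) :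
    0 < (-1) ^ j * ∏ i ∈ (Finset.range (m + 1)).erase j,
      (chebyshevZero m j - chebyshevZero m i)⁻¹ := by
  have h₁ : 0 < ∏ i ∈ Finset.range j, ((-1) * (chebyshevZero m j - chebyshevZero m i)⁻¹) :=
    Finset.prod_pos fun i hi => mul_pos_of_neg_of_neg neg_one_lt_zero <| inv_lt_zero.2 <|
      sub_neg.mpr <| chebyshevZero_lt hj (Finset.mem_range.mp hi)
  rw [Finset.prod_mul_distrib, Finset.prod_const, Finset.card_range] at h₁
  have h₂ : 0 < ∏ i ∈ Finset.Ioc j m, (chebyshevZero m j - chebyshevZero m i)⁻¹ :=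
    Finset.prod_pos fun i hi => inv_pos.2 <| sub_pos.mpr <|
      chebyshevZero_lt (Finset.mem_Ioc.mp hi).2 (Finset.mem_Ioc.mp hi).1
  have union : (Finset.range (m + 1)).erase j = Finset.range j ∪ Finset.Ioc j m := by grind
  have disjoint : Disjoint (Finset.range j) (Finset.Ioc j m) := by grind [Finset.disjoint_iff_ne]
  rw [union, Finset.prod_union disjoint, ← mul_assoc]
  exact mul_pos h₁ h₂

/-- Weights of Lagrange extrapolation from the Chebyshev zeros to the point `1`. -/
noncomputable def chebyshevWeight (m j : ℕ) : ℝ :=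
  (Lagrange.basis (Finset.range (m + 1)) (chebyshevZero m) j).eval 1

lemma chebyshevWeight_sign {m j : ℕ} (hj : j ≤ m) : 0 < (-1) ^ j * chebyshevWeight m j := by
  have hprod : chebyshevWeight m j =
      (∏ i ∈ (Finset.range (m + 1)).erase j, (chebyshevZero m j - chebyshevZero m i)⁻¹) *
        ∏ i ∈ (Finset.range (m + 1)).erase j, (1 - chebyshevZero m i) := by
    simp [chebyshevWeight, Lagrange.basis, Lagrange.basisDivisor, Polynomial.eval_prod,
      Finset.prod_mul_distrib]
  rw [hprod, ← mul_assoc]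
  refine mul_pos (prod_inv_chebyshevZero_sub_pos hj) (Finset.prod_pos fun i hi => sub_pos.2 ?_)
  have hi := chebyshevZero_angle_mem (Finset.mem_range_succ_iff.1 (Finset.mem_of_mem_erase hi))
  simpa [chebyshevZero] using Real.cos_lt_cos_of_nonneg_of_le_pi le_rfl hi.2.le hi.1

lemma sum_chebyshevWeight_mul_eval {m : ℕ} {q : Polynomial ℝ} (hq : q.degree < (m + 1 : ℕ)) :
    ∑ j ∈ Finset.range (m + 1), chebyshevWeight m j * q.eval (chebyshevZero m j) = q.eval 1 := by
  have hinj : Set.InjOn (chebyshevZero m) (Finset.range (m + 1)) := by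
    intro i hi j hj hij
    simp only [Finset.coe_range, Set.mem_Iio] at hi hj
    by_contra hne
    rcases lt_or_gt_of_ne hne with h | h
    · exact (chebyshevZero_lt (by omega : j ≤ m) h).ne' hij
    · exact (chebyshevZero_lt (by omega : i ≤ m) h).ne hij
  conv_rhs => rw [Lagrange.eq_interpolate (f := q) hinj (by simpa using hq)]
  simp [Lagrange.interpolate_apply, Polynomial.eval_finsetSum, chebyshevWeight, mul_comm]

lemma sqrt_one_sub_chebyshevZero_sq {m j : ℕ} (hj : j ≤ m) :
    √(1 - chebyshevZero m j ^ 2) = Real.sin ((2 * j + 1) * Real.pi / (2 * (m + 1))) := by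
  have h := chebyshevZero_angle_mem hj
  rw [chebyshevZero, ← Real.abs_sin_eq_sqrt_one_sub_cos_sq,
    abs_of_pos (Real.sin_pos_of_mem_Ioo h)]

lemma sum_abs_chebyshevWeight_div (m : ℕ) :
    ∑ j ∈ Finset.range (m + 1), |chebyshevWeight m j| / √(1 - chebyshevZero m j ^ 2) = m + 1 := by
  have hU := sum_chebyshevWeight_mul_eval (m := m) (q := Polynomial.Chebyshev.U ℝ m) (by
    rw [Polynomial.Chebyshev.degree_U_natCast]
    exact_mod_cast Nat.lt_succ_self m)
  rw [Polynomial.Chebyshev.U_eval_one] at hU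
  push_cast at hU
  rw [← hU]
  refine Finset.sum_congr rfl fun j hj => ?_
  have hj := Finset.mem_range_succ_iff.1 hj
  have hs := Real.sin_pos_of_mem_Ioo (chebyshevZero_angle_mem hj)
  have hw := chebyshevWeight_sign hj
  rw [sqrt_one_sub_chebyshevZero_sq hj, div_eq_iff hs.ne', mul_assoc, chebyshevZero,
    Polynomial.Chebyshev.U_real_cos]
  have harg : (((m : ℤ) : ℝ) + 1) * ((2 * j + 1) * Real.pi / (2 * (m + 1))) =
      Real.pi / 2 + j * Real.pi := by
    push_cast
    field_simp
    ring
  rw [harg, Real.sin_add_nat_mul_pi, Real.sin_pi_div_two, mul_one, mul_comm,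
    ← abs_of_pos hw, abs_mul, abs_neg_one_pow, one_mul]

/-- `f : ℝ → E` is a polynomial function of degree less than `n` with coefficients in `E`. -/
def IsPolyLT {E : Type*} [AddCommGroup E] [Module ℝ E] (n : ℕ) (f : ℝ → E) : Prop :=
  ∃ e : ℕ → E, ∀ c, f c = ∑ i ∈ Finset.range n, c ^ i • e i

namespace IsPolyLT

variable {E F : Type*} [AddCommGroup E] [Module ℝ E] [AddCommGroup F] [Module ℝ F]
  {n m : ℕ} {f g : ℝ → E}

lemma zero : IsPolyLT n (fun _ => (0 : E)) := ⟨0, by simp⟩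

lemma add (hf : IsPolyLT n f) (hg : IsPolyLT n g) : IsPolyLT n (fun c => f c + g c) := by
  obtain ⟨e, he⟩ := hf
  obtain ⟨d, hd⟩ := hg
  exact ⟨e + d, fun c => by simp [he, hd, Finset.sum_add_distrib]⟩

lemma map (hf : IsPolyLT n f) (L : E →ₗ[ℝ] F) : IsPolyLT n (fun c => L (f c)) := by
  obtain ⟨e, he⟩ := hf
  exact ⟨fun i => L (e i), fun c => by simp [he]⟩

lemma smul_var (hf : IsPolyLT n f) : IsPolyLT (n + 1) (fun c => c • f c) := by
  obtain ⟨e, he⟩ := hf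
  refine ⟨fun i => if i = 0 then 0 else e (i - 1), fun c => ?_⟩
  simp [he, Finset.sum_range_succ', Finset.smul_sum, smul_smul, pow_succ']

lemma mono (hf : IsPolyLT n f) (h : n ≤ m) : IsPolyLT m f := by
  obtain ⟨e, he⟩ := hf
  refine ⟨fun i => if i < n then e i else 0, fun c => ?_⟩
  rw [he, ← Finset.sum_subset (Finset.range_mono h)]
  · exact Finset.sum_congr rfl fun i hi => by simp [Finset.mem_range.1 hi]
  · intro i _ hi
    simp_all

lemma const (h : 0 < n) (x : E) : IsPolyLT n (fun _ => x) :=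
  IsPolyLT.mono (n := 1) ⟨fun _ => x, by simp⟩ h

lemma sum {ι : Type*} (s : Finset ι) {f : ι → ℝ → E} (hf : ∀ i ∈ s, IsPolyLT n (f i)) :
    IsPolyLT n (fun c => ∑ i ∈ s, f i c) := by
  classical
  induction s using Finset.induction_on with
  | empty => simpa using zero
  | insert a s ha ih =>
    simp only [Finset.sum_insert ha]
    exact (hf a (by simp)).add (ih fun i hi => hf i (by simp [hi]))

end IsPolyLT

/-- Schur's inequality at the endpoint: a vector valued polynomial `f` of degree less than `n` with
`√(1 - c²) ‖f c‖ ≤ C` on `[-1, 1]` satisfies `‖f 1‖ ≤ n C`. -/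
lemma IsPolyLT.norm_one_le {E : Type*} [NormedAddCommGroup E] [NormedSpace ℝ E] {n : ℕ}
    {f : ℝ → E} (hf : IsPolyLT n f) {C : ℝ}
    (hC : ∀ c ∈ Set.Icc (-1 : ℝ) 1, √(1 - c ^ 2) * ‖f c‖ ≤ C) : ‖f 1‖ ≤ n * C := by
  obtain ⟨e, he⟩ := hf
  obtain _ | m := n
  · simp [he]
  have hsum : f 1 = ∑ j ∈ Finset.range (m + 1), chebyshevWeight m j • f (chebyshevZero m j) := by
    simp only [he, Finset.smul_sum, smul_smul]
    rw [Finset.sum_comm]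
    refine Finset.sum_congr rfl fun i hi => ?_
    have := sum_chebyshevWeight_mul_eval (m := m) (q := Polynomial.X ^ i) (by
      rw [Polynomial.degree_X_pow]
      exact_mod_cast Finset.mem_range.1 hi)
    simp only [Polynomial.eval_pow, Polynomial.eval_X] at this
    rw [← Finset.sum_smul, this]
  calc ‖f 1‖ ≤ ∑ j ∈ Finset.range (m + 1), ‖chebyshevWeight m j • f (chebyshevZero m j)‖ := by
        rw [hsum]
        exact norm_sum_le _ _
    _ ≤ ∑ j ∈ Finset.range (m + 1),
        |chebyshevWeight m j| / √(1 - chebyshevZero m j ^ 2) * C := by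
        refine Finset.sum_le_sum fun j hj => ?_
        have hj := Finset.mem_range_succ_iff.1 hj
        have hs : 0 < √(1 - chebyshevZero m j ^ 2) := by
          rw [sqrt_one_sub_chebyshevZero_sq hj]
          exact Real.sin_pos_of_mem_Ioo (chebyshevZero_angle_mem hj)
        rw [norm_smul, Real.norm_eq_abs, div_mul_eq_mul_div, mul_div_assoc]
        refine mul_le_mul_of_nonneg_left ?_ (abs_nonneg _)
        rw [le_div_iff₀ hs, mul_comm]
        exact hC _ ⟨Real.neg_one_le_cos _, Real.cos_le_one _⟩
    _ = ((m + 1 : ℕ) : ℝ) * C := by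
        rw [← Finset.sum_mul, sum_abs_chebyshevWeight_div]
        push_cast
        rfl

section NoncommutativeDerivative

variable {R : Type*} [Ring R] [Algebra ℝ R]

/-- The derivative of `x ↦ x ^ n` at `x` in direction `y`, in a noncommutative algebra. -/
def powDeriv (x y : R) : ℕ → R
  | 0 => 0
  | n + 1 => y * x ^ n + x * powDeriv x y n

/-- The derivative of `x ↦ p(x)` at `x` in direction `y`, in a noncommutative algebra. -/
noncomputable def polyDeriv (p : Polynomial ℝ) (x y : R) : R :=
  ∑ i ∈ Finset.range (p.natDegree + 1), p.coeff i • powDeriv x y i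

lemma powDeriv_smul (x y : R) (c : ℝ) (n : ℕ) : powDeriv x (c • y) n = c • powDeriv x y n := by
  induction n with
  | zero => simp [powDeriv]
  | succ n ih => simp [powDeriv, ih, smul_add]

lemma polyDeriv_smul (p : Polynomial ℝ) (x y : R) (c : ℝ) :
    polyDeriv p x (c • y) = c • polyDeriv p x y := by
  simp only [polyDeriv, powDeriv_smul, Finset.smul_sum, smul_comm c]

lemma isPolyLT_polyDeriv_smul {p : Polynomial ℝ} {n : ℕ} (hp : p.natDegree ≤ n) (x y : R) :
    IsPolyLT n (fun c : ℝ => polyDeriv p (c • x) y) := by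
  have hpow (i : ℕ) : IsPolyLT (i + 1) (fun c : ℝ => (c • x) ^ i) := by
    induction i with
    | zero => simpa using IsPolyLT.const one_pos (1 : R)
    | succ i ih => simpa [pow_succ'] using (ih.map (LinearMap.mulLeft ℝ x)).smul_var
  have hderiv (i : ℕ) : IsPolyLT i (fun c : ℝ => powDeriv (c • x) y i) := by
    induction i with
    | zero => simpa [powDeriv] using IsPolyLT.zero
    | succ i ih =>
      simpa [powDeriv] using
        ((hpow i).map (LinearMap.mulLeft ℝ y)).add (ih.map (LinearMap.mulLeft ℝ x)).smul_var
  refine IsPolyLT.sum _ fun i hi => ?_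
  exact ((hderiv i).mono (by grind)).map (LinearMap.lsmul ℝ R (p.coeff i))

/-- Splitting of `(c x + σ y) ^ i`, for `c² + σ² = 1`, into its parts even and odd in `σ`. -/
lemma exists_even_odd_pow (x y : R) (i : ℕ) :
    ∃ a b : ℝ → R, IsPolyLT (i + 1) a ∧ IsPolyLT i b ∧ a 1 = x ^ i ∧ b 1 = powDeriv x y i ∧
      ∀ c σ : ℝ, c ^ 2 + σ ^ 2 = 1 → (c • x + σ • y) ^ i = a c + σ • b c := by
  induction i with
  | zero =>
    exact ⟨fun _ => 1, fun _ => 0, IsPolyLT.const one_pos _, IsPolyLT.zero, by simp, rfl, by simp⟩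
  | succ i ih =>
    obtain ⟨a, b, ha, hb, ha1, hb1, hab⟩ := ih
    have hyb := hb.map (LinearMap.mulLeft ℝ y)
    refine ⟨fun c => c • (x * a c) + (y * b c + c • c • (-(y * b c))),
      fun c => y * a c + c • (x * b c), ?_, ?_, ?_, ?_, ?_⟩
    · exact (ha.map (LinearMap.mulLeft ℝ x)).smul_var.add
        ((hyb.mono (by omega)).add (hyb.map (-LinearMap.id)).smul_var.smul_var)
    · exact (ha.map (LinearMap.mulLeft ℝ y)).add (hb.map (LinearMap.mulLeft ℝ x)).smul_var
    · simp [ha1, pow_succ']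
    · simp [ha1, hb1, powDeriv]
    · intro c σ h
      have hσ : σ * σ = 1 - c * c := by linarith
      rw [pow_succ', hab c σ h]
      simp only [add_mul, mul_add, smul_mul_assoc, mul_smul_comm, smul_smul]
      match_scalars <;> first | ring1 | linear_combination hσ

lemma exists_even_odd_aeval {p : Polynomial ℝ} {n : ℕ} (hp : p.natDegree ≤ n) (x y : R) :
    ∃ a b : ℝ → R, IsPolyLT n b ∧ b 1 = polyDeriv p x y ∧
      ∀ c σ : ℝ, c ^ 2 + σ ^ 2 = 1 → Polynomial.aeval (c • x + σ • y) p = a c + σ • b c := by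
  choose a b _ hb _ hb1 hab using exists_even_odd_pow x y
  refine ⟨fun c => ∑ i ∈ Finset.range (p.natDegree + 1), p.coeff i • a i c,
    fun c => ∑ i ∈ Finset.range (p.natDegree + 1), p.coeff i • b i c, ?_, ?_, ?_⟩
  · refine IsPolyLT.sum _ fun i hi => ?_
    exact ((hb i).mono (by grind)).map (LinearMap.lsmul ℝ R (p.coeff i))
  · simp [hb1, polyDeriv]
  · intro c σ h
    rw [Polynomial.aeval_eq_sum_range, Finset.smul_sum, ← Finset.sum_add_distrib]
    refine Finset.sum_congr rfl fun i _ => ?_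
    rw [hab i c σ h, smul_add, smul_comm σ]

end NoncommutativeDerivative

section OperatorMarkov

variable {R : Type*} [NormedRing R] [NormedAlgebra ℝ R]

lemma hasDerivAt_aeval_line (p : Polynomial ℝ) (x y : R) (t : ℝ) :
    HasDerivAt (fun t : ℝ => Polynomial.aeval (x + t • y) p) (polyDeriv p (x + t • y) y) t := by
  have hline : HasDerivAt (fun t : ℝ => x + t • y) y t := by
    simpa using ((hasDerivAt_id t).smul_const y).const_add x
  have hpow (i : ℕ) :
      HasDerivAt (fun t : ℝ => (x + t • y) ^ i) (powDeriv (x + t • y) y i) t := by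
    induction i with
    | zero => simpa [powDeriv] using hasDerivAt_const t (1 : R)
    | succ i ih =>
      simp only [pow_succ', powDeriv]
      exact hline.mul ih
  simp only [Polynomial.aeval_eq_sum_range, polyDeriv]
  exact HasDerivAt.fun_sum fun i _ => (hpow i).const_smul (p.coeff i)

variable {S : Submodule ℝ R} {p : Polynomial ℝ} {n : ℕ} {C : ℝ}

/-- Bernstein's inequality for a polynomial bounded on the unit ball of `S`. -/
lemma norm_polyDeriv_le_of_sq_add_sq_le (hp : p.natDegree ≤ n)
    (hC : ∀ x ∈ S, ‖x‖ ≤ 1 → ‖Polynomial.aeval x p‖ ≤ C) {x y : R} (hx : x ∈ S) (hy : y ∈ S)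
    (hxy : ‖x‖ ^ 2 + ‖y‖ ^ 2 ≤ 1) : ‖polyDeriv p x y‖ ≤ n * C := by
  obtain ⟨a, b, hb, hb1, hab⟩ := exists_even_odd_aeval hp x y
  rw [← hb1]
  refine hb.norm_one_le fun c hc => ?_
  have hbound (σ : ℝ) (h : c ^ 2 + σ ^ 2 = 1) : ‖Polynomial.aeval (c • x + σ • y) p‖ ≤ C := by
    refine hC _ (S.add_mem (S.smul_mem c hx) (S.smul_mem σ hy)) ((norm_add_le _ _).trans ?_)
    rw [norm_smul, norm_smul, Real.norm_eq_abs, Real.norm_eq_abs]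
    have h' : |c| ^ 2 + |σ| ^ 2 = 1 := by simpa using h
    nlinarith [sq_nonneg (|c| - ‖x‖), sq_nonneg (|σ| - ‖y‖)]
  set σ := √(1 - c ^ 2) with hσ
  have hσ2 : σ ^ 2 = 1 - c ^ 2 := Real.sq_sqrt (by nlinarith [hc.1, hc.2])
  have h1 : c ^ 2 + σ ^ 2 = 1 := by linarith
  have h2 : c ^ 2 + (-σ) ^ 2 = 1 := by linarith [neg_sq σ]
  have hdiff : (2 : ℝ) • σ • b c = Polynomial.aeval (c • x + σ • y) p -
      Polynomial.aeval (c • x + (-σ) • y) p := by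
    rw [hab c σ h1, hab c (-σ) h2]
    module
  have hn := (norm_sub_le _ _).trans (add_le_add (hbound σ h1) (hbound (-σ) h2))
  rw [← hdiff, norm_smul, norm_smul, Real.norm_of_nonneg (Real.sqrt_nonneg _)] at hn
  norm_num at hn
  linarith

/-- Markov's inequality for a polynomial bounded on the unit ball of `S`. -/
lemma norm_polyDeriv_le (hp : p.natDegree ≤ n)
    (hC : ∀ x ∈ S, ‖x‖ ≤ 1 → ‖Polynomial.aeval x p‖ ≤ C) {x y : R} (hx : x ∈ S) (hy : y ∈ S)
    (hx1 : ‖x‖ ≤ 1) : ‖polyDeriv p x y‖ ≤ n ^ 2 * C * ‖y‖ := by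
  have unit (y : R) (hy : y ∈ S) (hy1 : ‖y‖ ≤ 1) : ‖polyDeriv p x y‖ ≤ n ^ 2 * C := by
    have h := (isPolyLT_polyDeriv_smul hp x y).norm_one_le (C := n * C) fun c hc => by
      have hc2 : 0 ≤ 1 - c ^ 2 := by nlinarith [hc.1, hc.2]
      have h := norm_polyDeriv_le_of_sq_add_sq_le hp hC (S.smul_mem c hx)
        (S.smul_mem √(1 - c ^ 2) hy) (by
          rw [norm_smul, norm_smul, mul_pow, mul_pow, Real.norm_eq_abs, Real.norm_eq_abs, sq_abs,
            sq_abs, Real.sq_sqrt hc2]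
          have hx2 : ‖x‖ ^ 2 ≤ 1 := pow_le_one₀ (norm_nonneg _) hx1
          have hy2 : ‖y‖ ^ 2 ≤ 1 := pow_le_one₀ (norm_nonneg _) hy1
          nlinarith [sq_nonneg c])
      rwa [polyDeriv_smul, norm_smul, Real.norm_of_nonneg (Real.sqrt_nonneg _)] at h
    rw [one_smul] at h
    linarith
  rcases eq_or_ne y 0 with rfl | hy0
  · have := polyDeriv_smul p x (0 : R) 0
    simp_all
  · have hpos := norm_pos_iff.2 hy0
    have h := unit (‖y‖⁻¹ • y) (S.smul_mem _ hy) (by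
      rw [norm_smul, norm_inv, norm_norm, inv_mul_cancel₀ hpos.ne'])
    rwa [polyDeriv_smul, norm_smul, norm_inv, norm_norm, inv_mul_le_iff₀ hpos, mul_comm] at h

/-- A polynomial of degree at most `n` which is bounded by `C` on the unit ball of `S` is Lipschitz
on that ball with constant `n² C`. -/
lemma norm_aeval_sub_aeval_le (hp : p.natDegree ≤ n)
    (hC : ∀ x ∈ S, ‖x‖ ≤ 1 → ‖Polynomial.aeval x p‖ ≤ C) {x z : R} (hx : x ∈ S) (hz : z ∈ S)
    (hx1 : ‖x‖ ≤ 1) (hz1 : ‖z‖ ≤ 1) :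
    ‖Polynomial.aeval z p - Polynomial.aeval x p‖ ≤ n ^ 2 * C * ‖z - x‖ := by
  have h := norm_image_sub_le_of_norm_deriv_le_segment_01'
    (f := fun t : ℝ => Polynomial.aeval (x + t • (z - x)) p)
    (fun t _ => (hasDerivAt_aeval_line p x (z - x) t).hasDerivWithinAt)
    (C := n ^ 2 * C * ‖z - x‖) fun t ht => by
      refine norm_polyDeriv_le hp hC (S.add_mem hx (S.smul_mem t (S.sub_mem hz hx)))
        (S.sub_mem hz hx) ?_
      have : x + t • (z - x) = (1 - t) • x + t • z := by module
      rw [this]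
      refine (norm_add_le _ _).trans ?_
      rw [norm_smul, norm_smul, Real.norm_of_nonneg (sub_nonneg.2 ht.2.le),
        Real.norm_of_nonneg ht.1]
      nlinarith [ht.1, ht.2]
  simpa using h

end OperatorMarkov

section CStar

open Polynomial

variable {A : Type*} [CStarAlgebra A]

lemma abs_le_norm_of_mem_spectrum {a : A} {t : ℝ} (ht : t ∈ spectrum ℝ a) : |t| ≤ ‖a‖ := by
  rcases subsingleton_or_nontrivial A with h | h
  · simp [spectrum.of_subsingleton] at ht
  · simpa using spectrum.norm_le_norm_of_mem ht

lemma spectrum_star_mul_self_subset_Icc {a : A} (ha : ‖a‖ ≤ 1) :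
    spectrum ℝ (star a * a) ⊆ Set.Icc 0 1 := by
  intro t ht
  refine ⟨spectrum_star_mul_self_nonneg t ht, (le_abs_self t).trans ?_⟩
  refine (abs_le_norm_of_mem_spectrum ht).trans ?_
  rw [CStarRing.norm_star_mul_self]
  exact mul_le_one₀ ha (norm_nonneg _) ha

lemma norm_aeval_le_of_spectrum_subset {a : A} (ha : IsSelfAdjoint a) {s : Set ℝ}
    (hs : spectrum ℝ a ⊆ s) {p : ℝ[X]} {C : ℝ} (hC0 : 0 ≤ C) (hC : ∀ t ∈ s, |p.eval t| ≤ C) :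
    ‖aeval a p‖ ≤ C := by
  rw [← cfc_polynomial p a ha]
  exact norm_cfc_le hC0 fun t ht => hC t (hs ht)

/-- The operator version of Markov's inequality on `[0, 1]`. -/
lemma norm_aeval_sub_aeval_le_of_spectrum_subset_Icc {p : ℝ[X]} {n : ℕ} (hp : p.natDegree ≤ n)
    {C : ℝ} (hC : ∀ t ∈ Set.Icc (0 : ℝ) 1, |p.eval t| ≤ C) {a b : A}
    (ha : IsSelfAdjoint a) (hb : IsSelfAdjoint b) (ha1 : spectrum ℝ a ⊆ Set.Icc 0 1)
    (hb1 : spectrum ℝ b ⊆ Set.Icc 0 1) :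
    ‖aeval b p - aeval a p‖ ≤ 2 * n ^ 2 * C * ‖b - a‖ := by
  have hC0 : 0 ≤ C := (abs_nonneg _).trans (hC 0 (by simp))
  set q : ℝ[X] := p.comp (Polynomial.C (1 / 2) * X + Polynomial.C (1 / 2)) with hq
  have hqdeg : q.natDegree ≤ n := by
    refine natDegree_comp_le.trans ((Nat.mul_le_mul hp natDegree_linear_le).trans (by simp))
  set ℓ : ℝ[X] := Polynomial.C 2 * X - Polynomial.C 1 with hℓ
  have hcomp : q.comp ℓ = p := by
    rw [hq, comp_assoc]
    have : (Polynomial.C (1 / 2) * X + Polynomial.C (1 / 2) : ℝ[X]).comp ℓ = X := by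
      simp only [hℓ, add_comp, mul_comp, C_comp, X_comp, mul_sub, ← mul_assoc, ← C_mul]
      norm_num
    rw [this, comp_X]
  have hball {x : A} (hx : IsSelfAdjoint x) (hx1 : spectrum ℝ x ⊆ Set.Icc 0 1) :
      IsSelfAdjoint (aeval x ℓ) ∧ ‖aeval x ℓ‖ ≤ 1 := by
    refine ⟨?_, norm_aeval_le_of_spectrum_subset hx hx1 zero_le_one fun t ht => ?_⟩
    · rw [← cfc_polynomial ℓ x hx]
      exact cfc_predicate _ _
    · simp only [hℓ, eval_sub, eval_mul, eval_C, eval_X]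
      exact abs_le.2 ⟨by linarith [ht.1], by linarith [ht.2]⟩
  obtain ⟨has, han⟩ := hball ha ha1
  obtain ⟨hbs, hbn⟩ := hball hb hb1
  have h := norm_aeval_sub_aeval_le (S := selfAdjoint.submodule ℝ A) (C := C) hqdeg
    (fun x hx hx1 => norm_aeval_le_of_spectrum_subset (s := Set.Icc (-1) 1) hx
      (fun t ht => abs_le.1 ((abs_le_norm_of_mem_spectrum ht).trans hx1)) hC0 fun t ht => by
        rw [hq, eval_comp]
        refine hC _ ?_
        simp only [eval_add, eval_mul, eval_C, eval_X]
        exact ⟨by linarith [ht.1], by linarith [ht.2]⟩) has hbs han hbn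
  rw [← aeval_comp, ← aeval_comp, hcomp] at h
  have hsub : aeval b ℓ - aeval a ℓ = (2 : ℝ) • (b - a) := by
    simp [hℓ, mul_sub, Algebra.smul_def]
  rw [hsub, norm_smul] at h
  norm_num at h
  linarith

end CStar

section Residual

open Polynomial

variable {r g : ℝ[X]} {k : ℕ} {κ : ℝ}

lemma eq_one_sub_X_mul (hrg : ∀ x : ℝ, r.eval x = 1 - x * g.eval x) : r = 1 - X * g :=
  Polynomial.funext fun x => by simp [hrg]

lemma abs_eval_le_of_residual (hdeg : r.natDegree ≤ k)
    (hrg : ∀ x : ℝ, r.eval x = 1 - x * g.eval x)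
    (hi : ∀ x ∈ Set.Icc (0 : ℝ) 1, |r.eval x| ≤ κ) {t : ℝ} (ht : t ∈ Set.Icc (0 : ℝ) 1) :
    |g.eval t| ≤ 2 * κ * k ^ 2 := by
  have hpos (t : ℝ) (ht : t ∈ Set.Ioc (0 : ℝ) 1) : |g.eval t| ≤ 2 * κ * k ^ 2 := by
    have hspec {s : ℝ} (hs : s ∈ Set.Icc (0 : ℝ) 1) :
        spectrum ℝ (algebraMap ℝ ℂ s) ⊆ Set.Icc 0 1 := by
      rw [spectrum.scalar_eq]
      simpa using hs
    have hsa (s : ℝ) : IsSelfAdjoint (algebraMap ℝ ℂ s) := by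
      simp [IsSelfAdjoint]
    have h := norm_aeval_sub_aeval_le_of_spectrum_subset_Icc hdeg hi (hsa 0) (hsa t)
      (hspec (by simp)) (hspec ⟨ht.1.le, ht.2⟩)
    rw [aeval_algebraMap_apply, aeval_algebraMap_apply, ← map_sub, ← map_sub, norm_algebraMap',
      norm_algebraMap', coe_aeval_eq_eval, coe_aeval_eq_eval, hrg, hrg, Real.norm_eq_abs,
      Real.norm_eq_abs] at h
    have h0 : (1 - t * g.eval t - (1 - 0 * g.eval 0)) = -(t * g.eval t) := by ring
    rw [h0, abs_neg, abs_mul, sub_zero, abs_of_pos ht.1] at h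
    refine le_of_mul_le_mul_left ?_ ht.1
    linarith
  have hcl : t ∈ closure (Set.Ioc (0 : ℝ) 1) := by rwa [closure_Ioc zero_ne_one]
  exact closure_minimal hpos (isClosed_le g.continuous.abs continuous_const) hcl

variable {A : Type*} [CStarAlgebra A]

lemma norm_aeval_mul_star_le (hκ : 1 ≤ κ) (hdeg : r.natDegree ≤ k)
    (hrg : ∀ x : ℝ, r.eval x = 1 - x * g.eval x)
    (hi : ∀ x ∈ Set.Icc (0 : ℝ) 1, |r.eval x| ≤ κ) {b : A} (hb : ‖b‖ ≤ 1) :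
    ‖aeval (star b * b) g * star b‖ ≤ 2 * κ * k := by
  have hsa : IsSelfAdjoint (star b * b) := IsSelfAdjoint.star_mul_self b
  have hg : star (aeval (star b * b) g) = aeval (star b * b) g := by
    rw [← cfc_polynomial g _ hsa]
    exact (cfc_predicate g.eval (star b * b) : IsSelfAdjoint (cfc g.eval (star b * b)))
  have hsq : ‖aeval (star b * b) g * star b‖ * ‖aeval (star b * b) g * star b‖ ≤
      (2 * κ) * (2 * κ * k ^ 2) := by
    rw [← CStarRing.norm_self_mul_star]
    have : aeval (star b * b) g * star b * star (aeval (star b * b) g * star b) =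
        aeval (star b * b) (g * X * g) := by
      simp [hg, mul_assoc]
    rw [this]
    refine norm_aeval_le_of_spectrum_subset hsa (spectrum_star_mul_self_subset_Icc hb)
      (by positivity) fun t ht => ?_
    rw [eval_mul, eval_mul, eval_X, abs_mul]
    refine mul_le_mul ?_ (abs_eval_le_of_residual hdeg hrg hi ht) (abs_nonneg _) (by positivity)
    have h1 : g.eval t * t = 1 - r.eval t := by rw [hrg]; ring
    have h2 := abs_le.1 (hi t ht)
    rw [h1, abs_le]
    constructor <;> linarith
  refine (sq_le_sq₀ (norm_nonneg _) (by positivity)).1 ?_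
  nlinarith

end Residual


open ContinuousLinearMap in
theorem stmt_6 {X : Type*} [NormedAddCommGroup X] [InnerProductSpace ℂ X] [CompleteSpace X]
    (A AΩ : X →L[ℂ] X) (hA : ‖A‖ ≤ 1) (hAΩ : ‖AΩ‖ ≤ 1)
    (μ ρ δ : ℝ) (hμ : 0 < μ) (hρ : 0 < ρ) (hδ : 0 < δ)
    (v : X) (hv : ‖v‖ ≤ ρ)
    (xdag : X) (hxdag : xdag = (cfc (fun t : ℝ => t ^ (μ / 2)) (adjoint A * A)) v)
    (f : X) (hf : f = A xdag)
    (fδ : X) (hfδ : ‖f - fδ‖ ≤ δ)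
    (k : ℕ) (hk : 1 ≤ k) (κ₀ κμ : ℝ) (hκ₀ : 1 ≤ κ₀) (hκμ : 0 < κμ)
    (r g : Polynomial ℝ) (hdeg : r.natDegree ≤ k) (hr0 : r.eval 0 = 1)
    (hrg : ∀ x : ℝ, r.eval x = 1 - x * g.eval x)
    (hi : ∀ x ∈ Set.Icc (0:ℝ) 1, |r.eval x| ≤ κ₀)
    (hii : ∀ x ∈ Set.Icc (0:ℝ) 1, x ^ (μ / 2) * |r.eval x| ≤ κμ / ((k : ℝ) + 1) ^ μ) :
    ‖xdag - (Polynomial.aeval (adjoint AΩ * AΩ) (g.map (algebraMap ℝ ℂ))) (adjoint AΩ fδ)‖ ≤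
      κμ * ρ * (k : ℝ) ^ (-μ) + 2 * κ₀ * (k : ℝ) * δ +
        2 * κ₀ * (k : ℝ) ^ 2 * ‖xdag‖ *
          (‖adjoint A * A - adjoint AΩ * AΩ‖ + ‖adjoint AΩ * (AΩ - A)‖) := by
  have hsaA : IsSelfAdjoint (adjoint A * A) := IsSelfAdjoint.star_mul_self A
  have hsaΩ : IsSelfAdjoint (adjoint AΩ * AΩ) := IsSelfAdjoint.star_mul_self AΩ
  have hspecA : spectrum ℝ (adjoint A * A) ⊆ Set.Icc 0 1 := spectrum_star_mul_self_subset_Icc hA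
  have hspecΩ : spectrum ℝ (adjoint AΩ * AΩ) ⊆ Set.Icc 0 1 :=
    spectrum_star_mul_self_subset_Icc hAΩ
  have hk0 : (0 : ℝ) < k := by exact_mod_cast hk
  rw [Polynomial.aeval_map_algebraMap]
  set B := adjoint A * A with hB
  set BΩ := adjoint AΩ * AΩ with hBΩ
  set G := Polynomial.aeval BΩ g with hG
  have hres : Polynomial.aeval BΩ r = 1 - G * BΩ := by
    rw [eq_one_sub_X_mul hrg, mul_comm]
    simp [hG]
  have hdecomp : xdag - G (adjoint AΩ fδ) =
      Polynomial.aeval B r xdag + (G * adjoint AΩ) (f - fδ) +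
        ((Polynomial.aeval BΩ r - Polynomial.aeval B r) xdag +
          (G * (adjoint AΩ * (AΩ - A))) xdag) := by
    rw [hres, hf, hBΩ]
    simp only [sub_apply, one_apply_eq_self, mul_apply_eq_comp, map_sub]
    abel
  have hsource : ‖Polynomial.aeval B r xdag‖ ≤ κμ * ρ * (k : ℝ) ^ (-μ) := by
    have hcont : Continuous fun t : ℝ => t ^ (μ / 2) :=
      Real.continuous_rpow_const (by positivity)
    have hnorm : ‖Polynomial.aeval B r * cfc (fun t : ℝ => t ^ (μ / 2)) B‖ ≤
        κμ / ((k : ℝ) + 1) ^ μ := by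
      rw [← cfc_polynomial r B hsaA, ← cfc_mul _ _ B r.continuous.continuousOn hcont.continuousOn]
      refine norm_cfc_le (by positivity) fun t ht => ?_
      have ht := hspecA ht
      rw [norm_mul, Real.norm_eq_abs, Real.norm_of_nonneg (Real.rpow_nonneg ht.1 _), mul_comm]
      exact hii t ht
    rw [hxdag, ← mul_apply_eq_comp]
    calc _ ≤ κμ / ((k : ℝ) + 1) ^ μ * ρ :=
          le_of_opNorm_le_of_le _ hnorm hv
      _ ≤ κμ / (k : ℝ) ^ μ * ρ := by
          gcongr
          linarith
      _ = _ := by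
          rw [Real.rpow_neg hk0.le]
          ring
  have hnoise : ‖(G * adjoint AΩ) (f - fδ)‖ ≤ 2 * κ₀ * k * δ :=
    le_of_opNorm_le_of_le _ (norm_aeval_mul_star_le hκ₀ hdeg hrg hi hAΩ) hfδ
  have hlip : ‖(Polynomial.aeval BΩ r - Polynomial.aeval B r) xdag‖ ≤
      2 * k ^ 2 * κ₀ * ‖BΩ - B‖ * ‖xdag‖ :=
    le_of_opNorm_le _ (norm_aeval_sub_aeval_le_of_spectrum_subset_Icc hdeg hi hsaA hsaΩ
      hspecA hspecΩ) _
  have hoper : ‖(G * (adjoint AΩ * (AΩ - A))) xdag‖ ≤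
      2 * κ₀ * k ^ 2 * ‖adjoint AΩ * (AΩ - A)‖ * ‖xdag‖ := by
    refine le_of_opNorm_le _ ((norm_mul_le _ _).trans ?_) _
    gcongr
    exact norm_aeval_le_of_spectrum_subset hsaΩ hspecΩ (by positivity) fun t ht =>
      abs_eval_le_of_residual hdeg hrg hi ht
  rw [hdecomp, norm_sub_rev B BΩ]
  refine (norm_add_le _ _).trans ((add_le_add ((norm_add_le _ _).trans (add_le_add hsource hnoise))
    ((norm_add_le _ _).trans (add_le_add hlip hoper))).trans_eq ?_)
  ring
end
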